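/- Let r₁, r₂ : ℍ ≃ᵢ ℍ be isometries of the hyperbolic plane with rᵢ ∘ rᵢ equal to the identity, and let γ₁, γ₂ : ℝ → ℍ be isometric embeddings such that the fixed-point set of rᵢ is exactly the range of γᵢ (i = 1, 2). Suppose there are points p₁ in the range of γ₁ and p₂ in the range of γ₂ such that δ := dist(p₁, p₂) > 0 and δ ≤ dist(q₁, q₂) for all q₁ in the range of γ₁ and all q₂ in the range of γ₂. Then for every z ∈ ℍ one has dist(z, (r₂ ∘ r₁) z) ≥ 2δ, and dist(p₁, (r₂ ∘ r₁) p₁) = 2δ; hence r₂ ∘ r₁ is a hyperbolic isometry with translation length 2δ. -/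

import Mathlib

open UpperHalfPlane

theorem Real.cosh_eq_two_mul_cosh_half_sq (x : ℝ) : cosh x = 2 * cosh (x / 2) ^ 2 - 1 := by
  have h := cosh_sq (x / 2)
  have h' := cosh_two_mul (x / 2)
  rw [mul_div_cancel₀ _ (two_ne_zero' ℝ)] at h'
  linarith

namespace UpperHalfPlane

/-- The midpoint `m` of `a` and `b`, characterized by its distances to all points: in the
hyperboloid model, `m` is the normalization of `a + b`. -/
theorem exists_midpoint_cosh_dist (a b : ℍ) : ∃ m : ℍ, ∀ x : ℍ,
    Real.cosh (dist x m) * (2 * Real.cosh (dist a b / 2)) =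
      Real.cosh (dist x a) + Real.cosh (dist x b) := by
  have hk : 0 < 2 * Real.cosh (dist a b / 2) := by positivity
  have hk2 : (2 * Real.cosh (dist a b / 2)) ^ 2 = 2 + 2 * Real.cosh (dist a b) := by
    rw [Real.cosh_eq_two_mul_cosh_half_sq (dist a b)]
    ring
  generalize 2 * Real.cosh (dist a b / 2) = k at hk hk2
  have ha := a.im_pos
  have hb := b.im_pos
  rw [cosh_dist'] at hk2
  refine ⟨⟨⟨(a.re * b.im + b.re * a.im) / (a.im + b.im), k * a.im * b.im / (a.im + b.im)⟩,
    by positivity⟩, fun x => ?_⟩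
  have hx := x.im_pos
  simp only [cosh_dist', mk_re, mk_im]
  generalize a.re = a₁, a.im = a₂, b.re = b₁, b.im = b₂, x.re = x₁, x.im = x₂ at *
  field_simp at hk2 ⊢
  linear_combination (a₂ * b₂) * hk2

/-- Midpoints are at half the distance from the endpoints. -/
theorem dist_left_eq_half_of_cosh_dist {a b m : ℍ} (hm : ∀ x : ℍ,
    Real.cosh (dist x m) * (2 * Real.cosh (dist a b / 2)) =
      Real.cosh (dist x a) + Real.cosh (dist x b)) : dist a m = dist a b / 2 := by
  have h := hm a
  rw [dist_self, Real.cosh_zero, Real.cosh_eq_two_mul_cosh_half_sq (dist a b)] at h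
  have h₃ : Real.cosh (dist a m) = Real.cosh (dist a b / 2) := by
    apply mul_right_cancel₀ (b := 2 * Real.cosh (dist a b / 2)) (by positivity)
    linarith
  exact Real.cosh_strictMonoOn.injOn dist_nonneg (Set.mem_Ici.2 (by positivity)) h₃

/-- An involutive isometry fixes the midpoint of every point and its image. -/
theorem exists_fixed_midpoint (r : ℍ ≃ᵢ ℍ) (hr : Function.Involutive r) (a : ℍ) :
    ∃ m : ℍ, r m = m ∧ ∀ x : ℍ,
      Real.cosh (dist x m) * (2 * Real.cosh (dist a (r a) / 2)) =
        Real.cosh (dist x a) + Real.cosh (dist x (r a)) := by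
  obtain ⟨m, hm⟩ := exists_midpoint_cosh_dist a (r a)
  have h₁ : dist a m = dist a (r a) / 2 := dist_left_eq_half_of_cosh_dist hm
  have h₂ : dist (r a) m = dist a (r a) / 2 := by
    rw [← dist_comm (r a) a]
    refine dist_left_eq_half_of_cosh_dist fun x => ?_
    rw [dist_comm (r a) a, hm, add_comm]
  refine ⟨m, ?_, hm⟩
  have h := hm (r m)
  have h₃ : dist (r m) a = dist a (r a) / 2 := by
    rw [← h₂, ← r.dist_eq (r a) m, hr a, dist_comm]
  rw [h₃, r.dist_eq, dist_comm m a, h₁, ← two_mul] at h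
  have h₄ : Real.cosh (dist (r m) m) = 1 :=
    (mul_eq_right₀ (by positivity)).1 h
  by_contra hne
  exact (Real.one_lt_cosh.2 (dist_ne_zero.2 hne)).ne' h₄

end UpperHalfPlane

/-- For nonnegative reals satisfying the triangle inequalities, the hyperbolic Gram determinant
of the hyperbolic cosines is nonnegative. -/
theorem Real.cosh_sq_add_cosh_sq_add_cosh_sq_le {a b c : ℝ} (hc : 0 ≤ c)
    (hab : |a - b| ≤ c) (habc : c ≤ a + b) :
    cosh a ^ 2 + cosh b ^ 2 + cosh c ^ 2 ≤ 2 * cosh a * cosh b * cosh c + 1 := by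
  have h₁ : cosh (a - b) ≤ cosh c := by rwa [cosh_le_cosh, abs_of_nonneg hc]
  have h₂ : cosh c ≤ cosh (a + b) := by
    rwa [cosh_le_cosh, abs_of_nonneg hc, abs_of_nonneg (hc.trans habc)]
  rw [cosh_sub] at h₁
  rw [cosh_add] at h₂
  have h₃ := mul_nonneg (sub_nonneg.2 h₁) (sub_nonneg.2 h₂)
  have ha := cosh_sq a
  have hb := cosh_sq b
  have h₄ : (sinh a * sinh b) ^ 2 = (cosh a ^ 2 - 1) * (cosh b ^ 2 - 1) := by
    rw [ha, hb]; ring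
  linarith

/-- The images of a point under two involutive isometries are at least twice as far apart as the
fixed-point sets of the isometries. -/
theorem UpperHalfPlane.two_mul_le_dist_of_involutive (r₁ r₂ : ℍ ≃ᵢ ℍ)
    (h₁ : Function.Involutive r₁) (h₂ : Function.Involutive r₂) (δ : ℝ)
    (hδ : ∀ q₁ q₂ : ℍ, r₁ q₁ = q₁ → r₂ q₂ = q₂ → δ ≤ dist q₁ q₂) (w : ℍ) :
    2 * δ ≤ dist (r₁ w) (r₂ w) := by
  obtain ⟨m, hm, hm'⟩ := exists_fixed_midpoint r₁ h₁ w
  obtain ⟨n, hn, hn'⟩ := exists_fixed_midpoint r₂ h₂ w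
  suffices h : dist m n ≤ dist (r₁ w) (r₂ w) / 2 by linarith [hδ m n hm hn]
  have e₀ := hn' m
  have e₁ := hm' w
  have e₂ := hm' (r₂ w)
  rw [dist_comm m w, dist_comm m (r₂ w)] at e₀
  rw [dist_self, Real.cosh_zero] at e₁
  rw [dist_comm (r₂ w) w, dist_comm (r₂ w) (r₁ w)] at e₂
  have htri : Real.cosh (dist w (r₁ w) / 2) ^ 2 + Real.cosh (dist w (r₂ w) / 2) ^ 2 +
      Real.cosh (dist (r₁ w) (r₂ w) / 2) ^ 2 ≤ 2 * Real.cosh (dist w (r₁ w) / 2) *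
        Real.cosh (dist w (r₂ w) / 2) * Real.cosh (dist (r₁ w) (r₂ w) / 2) + 1 := by
    have t₁ := dist_triangle_left (r₁ w) (r₂ w) w
    have t₂ := dist_triangle w (r₁ w) (r₂ w)
    have t₃ := dist_triangle_right w (r₁ w) (r₂ w)
    apply Real.cosh_sq_add_cosh_sq_add_cosh_sq_le (by positivity) (abs_le.2 ⟨?_, ?_⟩) <;> linarith
  rw [Real.cosh_eq_two_mul_cosh_half_sq (dist w (r₁ w))] at e₁
  rw [Real.cosh_eq_two_mul_cosh_half_sq (dist w (r₂ w)),
    Real.cosh_eq_two_mul_cosh_half_sq (dist (r₁ w) (r₂ w))] at e₂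
  have hA := Real.cosh_pos (dist w (r₁ w) / 2)
  have hB := Real.cosh_pos (dist w (r₂ w) / 2)
  have key : Real.cosh (dist m n) ≤ Real.cosh (dist (r₁ w) (r₂ w) / 2) := by
    refine le_of_mul_le_mul_right ?_ (mul_pos (mul_pos four_pos hA) hB)
    linear_combination 2 * htri + 2 * Real.cosh (dist w (r₁ w) / 2) * e₀ + e₁ + e₂
  rwa [Real.cosh_le_cosh, abs_of_nonneg dist_nonneg, abs_of_nonneg (by positivity)] at key

/-- The composition of the reflections about two geodesic lines of the hyperbolic plane
(at positive distance `δ`, attained at points `p₁`, `p₂`) is a hyperbolic isometry of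
translation length `2 * δ`: every point is displaced by at least `2 * δ`, and the
point `p₁` is displaced by exactly `2 * δ`. -/
theorem reflection_comp_hyperbolic (r₁ r₂ : ℍ ≃ᵢ ℍ) (γ₁ γ₂ : ℝ → ℍ)
    (hγ₁ : Isometry γ₁) (hγ₂ : Isometry γ₂)
    (hinv₁ : (⇑r₁) ∘ (⇑r₁) = id) (hinv₂ : (⇑r₂) ∘ (⇑r₂) = id)
    (hfix₁ : {p : ℍ | r₁ p = p} = Set.range γ₁)
    (hfix₂ : {p : ℍ | r₂ p = p} = Set.range γ₂)
    (p₁ p₂ : ℍ) (hp₁ : p₁ ∈ Set.range γ₁) (hp₂ : p₂ ∈ Set.range γ₂)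
    (δ : ℝ) (hδ : δ = dist p₁ p₂) (hδpos : 0 < δ)
    (hmin : ∀ q₁ ∈ Set.range γ₁, ∀ q₂ ∈ Set.range γ₂, δ ≤ dist q₁ q₂) :
    (∀ z : ℍ, 2 * δ ≤ dist z (r₂ (r₁ z))) ∧
    dist p₁ (r₂ (r₁ p₁)) = 2 * δ := by
  have h₁ : Function.Involutive r₁ := congrFun hinv₁
  have h₂ : Function.Involutive r₂ := congrFun hinv₂
  have hle (z : ℍ) : 2 * δ ≤ dist z (r₂ (r₁ z)) := by
    have h := UpperHalfPlane.two_mul_le_dist_of_involutive r₁ r₂ h₁ h₂ δ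
      (fun q₁ q₂ hq₁ hq₂ => hmin q₁ (hfix₁ ▸ hq₁) q₂ (hfix₂ ▸ hq₂)) (r₁ z)
    rwa [h₁ z] at h
  refine ⟨hle, (hle p₁).antisymm' ?_⟩
  have e₁ : r₁ p₁ = p₁ := by rwa [← hfix₁] at hp₁
  have e₂ : r₂ p₂ = p₂ := by rwa [← hfix₂] at hp₂
  have h := dist_triangle p₁ p₂ (r₂ p₁)
  have h' : dist p₂ (r₂ p₁) = dist p₁ p₂ := by
    rw [← r₂.dist_eq p₁ p₂, e₂, dist_comm]
  rw [e₁]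
  linarith
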